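/- arXiv:2410.12729 — 4 statements merged into one kernel-verified Lean document; each statement's English description precedes it below -/
import Mathlib

section
/- Let p₁, p₂, p₃, p₄ ∈ ℝ³ with det(p₁,p₂,p₃) ≠ 0 and det(p₁,p₂,p₄) ≠ 0, and let π₁ and π₂ denote the affine planes spanned by p₁,p₂,p₃ and by p₁,p₂,p₄ respectively. If p₃′ is any point of π₁ not in π₂ and p₄′ is any point of π₂ not in π₁, then ω(p₁,p₂;p₃′,p₄′) = ω(p₁,p₂;p₃,p₄). In other words, the projective lifting coefficient depends only on the pair of planes π₁, π₂ and not on the choice of the auxiliary points p₃ ∈ π₁∖π₂ and p₄ ∈ π₂∖π₁. -/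
/-- Determinant of the 3×3 real matrix with columns `a`, `b`, `c`. -/
noncomputable def det3 (a b c : Fin 3 → ℝ) : ℝ :=
  Matrix.det (Matrix.transpose (Matrix.of ![a, b, c]))

/-- The projective lifting coefficient `ω(p₁,p₂;p₃,p₄)`. -/
noncomputable def liftingCoef (p₁ p₂ p₃ p₄ : Fin 3 → ℝ) : ℝ :=
  det3 (p₂ - p₁) (p₃ - p₁) (p₄ - p₁) / (det3 p₁ p₂ p₃ * det3 p₁ p₂ p₄)

/-- The affine span of three points consists of the first point plus the linear combinations of
the two edge vectors issuing from it. -/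
theorem mem_affineSpan_triple {k V : Type*} [Ring k] [AddCommGroup V] [Module k V]
    {a b c p : V} :
    p ∈ affineSpan k ({a, b, c} : Set V) ↔
      ∃ s t : k, s • (b - a) + t • (c - a) + a = p := by
  have ha : a ∈ affineSpan k ({a, b, c} : Set V) := mem_affineSpan k (by simp)
  rw [← AffineSubspace.vsub_right_mem_direction_iff_mem ha, direction_affineSpan,
    vectorSpan_eq_span_vsub_set_right k (by simp : a ∈ ({a, b, c} : Set V))]
  simp only [Set.image_insert_eq, Set.image_singleton, vsub_eq_sub, sub_self,
    Submodule.span_insert_zero, Submodule.mem_span_pair, eq_sub_iff_add_eq]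

theorem det3_smul_sub_add_smul_sub_add (a b c : Fin 3 → ℝ) (s t : ℝ) :
    det3 a b (s • (b - a) + t • (c - a) + a) = t * det3 a b c := by
  simp [det3, Matrix.det_fin_three]
  ring

theorem det3_sub_smul_sub_add (a b c d : Fin 3 → ℝ) (s t u v : ℝ) :
    det3 (b - a) (s • (b - a) + t • (c - a) + a - a) (u • (b - a) + v • (d - a) + a - a) =
      t * v * det3 (b - a) (c - a) (d - a) := by
  simp [det3, Matrix.det_fin_three]
  ring

/-- The projective lifting coefficient does not depend on the choice of the
auxiliary points `p₃' ∈ π₁ \ π₂` and `p₄' ∈ π₂ \ π₁`. -/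
theorem liftingCoef_independent_of_aux_points
    (p₁ p₂ p₃ p₄ p₃' p₄' : Fin 3 → ℝ)
    (h₃ : det3 p₁ p₂ p₃ ≠ 0) (h₄ : det3 p₁ p₂ p₄ ≠ 0)
    (h₃'mem : p₃' ∈ affineSpan ℝ ({p₁, p₂, p₃} : Set (Fin 3 → ℝ)))
    (h₃'nmem : p₃' ∉ affineSpan ℝ ({p₁, p₂, p₄} : Set (Fin 3 → ℝ)))
    (h₄'mem : p₄' ∈ affineSpan ℝ ({p₁, p₂, p₄} : Set (Fin 3 → ℝ)))
    (h₄'nmem : p₄' ∉ affineSpan ℝ ({p₁, p₂, p₃} : Set (Fin 3 → ℝ))) :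
    liftingCoef p₁ p₂ p₃' p₄' = liftingCoef p₁ p₂ p₃ p₄ := by
  obtain ⟨s, t, rfl⟩ := mem_affineSpan_triple.1 h₃'mem
  obtain ⟨u, v, rfl⟩ := mem_affineSpan_triple.1 h₄'mem
  have ht : t ≠ 0 := by
    rintro rfl
    exact h₃'nmem (mem_affineSpan_triple.2 ⟨s, 0, by simp⟩)
  have hv : v ≠ 0 := by
    rintro rfl
    exact h₄'nmem (mem_affineSpan_triple.2 ⟨u, 0, by simp⟩)
  simp only [liftingCoef, det3_smul_sub_add_smul_sub_add, det3_sub_smul_sub_add]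
  field_simp
end

section
/- Let k ≥ 3, let p₀ ∈ ℝ³, and let p : ZMod k → ℝ³ satisfy det(p₀, p(i), p(i+1)) ≠ 0 for every i. Let n ∈ ℝ³ define the affine plane π = {x ∈ ℝ³ : ⟨n,x⟩ = 1} (an arbitrary affine plane not through the origin), and assume ⟨n,p₀⟩ ≠ 0 and ⟨n,p(i)⟩ ≠ 0 for all i. Set β₀ = ⟨n,p₀⟩, βᵢ = ⟨n,p(i)⟩, and let p̄₀ = p₀/β₀ and p̄ᵢ = p(i)/βᵢ be the central projections from the origin of p₀ and p(i) to π. Then Σᵢ β₀ βᵢ ω(p₀, p(i); p(i−1), p(i+1)) · (p̄ᵢ − p̄₀) = 0. That is, the projection-stress ω̄ᵢⱼ = βᵢβⱼωᵢⱼ satisfies the Euclidean equilibrium condition at the projected vertex p̄₀; since self-stressability is imposed vertex by vertex, this establishes that the projection-stress is a self-stress of the projection-framework of a projectively non-degenerate polyhedral surface. -/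
open Matrix

/-- The functional taking the value `1` at `a`, `b`, `c`, as a vector crossed with `n`. -/
noncomputable def crossFaceNormal (n a b c : Fin 3 → ℝ) : Fin 3 → ℝ :=
  (det3 a b c)⁻¹ • (n ⨯₃ (a ⨯₃ b + b ⨯₃ c + c ⨯₃ a))

theorem det3_swap_right (a b c : Fin 3 → ℝ) : det3 a b c = -det3 a c b := by
  simp only [det3, Matrix.det_fin_three, Matrix.transpose_apply, Matrix.of_apply,
    Matrix.cons_val]
  ring

theorem liftingCoef_smul_eq_sub (n a b c d : Fin 3 → ℝ)
    (hc : det3 a c b ≠ 0) (hd : det3 a b d ≠ 0) :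
    liftingCoef a b c d • ((n ⬝ᵥ a) • b - (n ⬝ᵥ b) • a) =
      crossFaceNormal n a b d - crossFaceNormal n a c b := by
  have key : det3 (b - a) (c - a) (d - a) • ((n ⬝ᵥ a) • b - (n ⬝ᵥ b) • a) =
      det3 a b d • (n ⨯₃ (a ⨯₃ c + c ⨯₃ b + b ⨯₃ a)) -
        det3 a c b • (n ⨯₃ (a ⨯₃ b + b ⨯₃ d + d ⨯₃ a)) := by
    ext j
    fin_cases j <;>
      simp [det3, Matrix.det_fin_three, cross_apply, dotProduct, Fin.sum_univ_three] <;> ring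
  rw [liftingCoef, crossFaceNormal, crossFaceNormal, det3_swap_right a b c, div_eq_inv_mul,
    mul_smul, key]
  ext j
  simp only [Pi.smul_apply, Pi.sub_apply, smul_eq_mul]
  field_simp
  ring

/-- The projection-stress `ω̄ᵢⱼ = βᵢβⱼωᵢⱼ` satisfies the Euclidean equilibrium
condition at the projected vertex `p̄₀` of the central projection (from the
origin) to the affine plane `{x : ⟨n,x⟩ = 1}`. -/
theorem projection_stress_equilibrium (k : ℕ) [NeZero k] (hk : 3 ≤ k)
    (p₀ : Fin 3 → ℝ) (p : ZMod k → (Fin 3 → ℝ)) (n : Fin 3 → ℝ)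
    (h : ∀ i : ZMod k, det3 p₀ (p i) (p (i + 1)) ≠ 0)
    (hβ₀ : n ⬝ᵥ p₀ ≠ 0) (hβ : ∀ i : ZMod k, n ⬝ᵥ p i ≠ 0) :
    ∑ i : ZMod k,
      ((n ⬝ᵥ p₀) * (n ⬝ᵥ p i) *
          liftingCoef p₀ (p i) (p (i - 1)) (p (i + 1))) •
        ((n ⬝ᵥ p i)⁻¹ • p i - (n ⬝ᵥ p₀)⁻¹ • p₀) = 0 := by
  have hterm (i : ZMod k) :
      ((n ⬝ᵥ p₀) * (n ⬝ᵥ p i) * liftingCoef p₀ (p i) (p (i - 1)) (p (i + 1))) •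
        ((n ⬝ᵥ p i)⁻¹ • p i - (n ⬝ᵥ p₀)⁻¹ • p₀) =
      crossFaceNormal n p₀ (p i) (p (i + 1)) -
        crossFaceNormal n p₀ (p (i - 1)) (p (i - 1 + 1)) := by
    have hprev := h (i - 1)
    rw [sub_add_cancel] at hprev ⊢
    rw [← liftingCoef_smul_eq_sub n p₀ (p i) _ _ hprev (h i)]
    have hi := hβ i
    ext j
    simp only [Pi.smul_apply, Pi.sub_apply, smul_eq_mul]
    field_simp
  rw [Finset.sum_congr rfl fun i _ => hterm i, Finset.sum_sub_distrib, sub_eq_zero]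
  exact ((Equiv.subRight (1 : ZMod k)).sum_comp
    fun i => crossFaceNormal n p₀ (p i) (p (i + 1))).symm
end

section
/- Let p₁, p₂, p₃, p₄ ∈ ℤ³ with det(p₁,p₂,p₃) ≠ 0, det(p₁,p₂,p₄) ≠ 0, and det(p₂−p₁, p₃−p₁, p₄−p₁) ≠ 0. Let π₁ and π₂ be the affine planes through p₁,p₂,p₃ and through p₁,p₂,p₄. Let Isin(π₁,π₂) be the index in ℤ³ of the subgroup generated by all differences of pairs of integer points of π₁ together with all differences of pairs of integer points of π₂; let Iℓ(p₁,p₂) = gcd(p₂−p₁); and for j = 1,2 let Id(O,πⱼ) be the index in ℤ³ of the additive subgroup generated by the integer points lying on πⱼ (viewed as vectors from the origin O). Then |ω(p₁,p₂;p₃,p₄)| = Isin(π₁,π₂) / (Iℓ(p₁,p₂) · Id(O,π₁) · Id(O,π₂)); equivalently, |det(p₂−p₁,p₃−p₁,p₄−p₁)| · Iℓ(p₁,p₂) · Id(O,π₁) · Id(O,π₂) = Isin(π₁,π₂) · |det(p₁,p₂,p₃)| · |det(p₁,p₂,p₄)|. -/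
open Matrix

/-- The greatest common divisor of the three coordinates of `v ∈ ℤ³`. -/
def gcd3 (v : Fin 3 → ℤ) : ℕ :=
  Int.gcd (v 0) (Int.gcd (v 1) (v 2))

/-- Determinant of the 3×3 integer matrix with columns `a`, `b`, `c`. -/
def det3Z (a b c : Fin 3 → ℤ) : ℤ :=
  Matrix.det (Matrix.transpose (Matrix.of ![a, b, c]))

/-- Coordinatewise cast `ℤ³ → ℝ³` as an additive group homomorphism. -/
def castR3 : (Fin 3 → ℤ) →+ (Fin 3 → ℝ) where
  toFun v := fun i => (v i : ℝ)
  map_zero' := by ext i; simp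
  map_add' u v := by ext i; simp

/-- The set of differences of pairs of integer points of the affine plane
through the casts of `a`, `b`, `c`. -/
def planeDiffs (a b c : Fin 3 → ℤ) : Set (Fin 3 → ℤ) :=
  {d : Fin 3 → ℤ | ∃ q ∈ {x : Fin 3 → ℤ |
      castR3 x ∈ affineSpan ℝ ({castR3 a, castR3 b, castR3 c} : Set (Fin 3 → ℝ))},
    ∃ q' ∈ {x : Fin 3 → ℤ |
      castR3 x ∈ affineSpan ℝ ({castR3 a, castR3 b, castR3 c} : Set (Fin 3 → ℝ))},
    d = q - q'}

/-- `Id(O,π)`: the index in `ℤ³` of the additive subgroup generated by the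
integer points lying on the affine plane `π` through the casts of `a,b,c`
(viewed as vectors from the origin). -/
noncomputable def intDistOrigin (a b c : Fin 3 → ℤ) : ℕ :=
  (AddSubgroup.closure {x : Fin 3 → ℤ |
    castR3 x ∈ affineSpan ℝ ({castR3 a, castR3 b, castR3 c} : Set (Fin 3 → ℝ))}).index

lemma exists_dotProduct_eq_gcd3 (v : Fin 3 → ℤ) : ∃ w : Fin 3 → ℤ, v ⬝ᵥ w = gcd3 v := by
  have h₁ := Int.gcd_eq_gcd_ab (v 0) (Int.gcd (v 1) (v 2))
  have h₂ := Int.gcd_eq_gcd_ab (v 1) (v 2)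
  set r := Int.gcdB (v 0) (Int.gcd (v 1) (v 2))
  refine ⟨![Int.gcdA (v 0) (Int.gcd (v 1) (v 2)),
    Int.gcdA (v 1) (v 2) * r, Int.gcdB (v 1) (v 2) * r], ?_⟩
  simp only [dotProduct, Fin.sum_univ_three, gcd3, cons_val]
  rw [h₁]
  linear_combination (-r) * h₂

lemma gcd3_dvd (v : Fin 3 → ℤ) (i : Fin 3) : (gcd3 v : ℤ) ∣ v i := by
  have h : (gcd3 v : ℤ) ∣ (Int.gcd (v 1) (v 2) : ℤ) := Int.gcd_dvd_right _ _
  fin_cases i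
  · exact Int.gcd_dvd_left _ _
  · exact h.trans (Int.gcd_dvd_left _ _)
  · exact h.trans (Int.gcd_dvd_right _ _)

lemma gcd3_smul (k : ℤ) (v : Fin 3 → ℤ) : gcd3 (k • v) = k.natAbs * gcd3 v := by
  simp only [gcd3, Pi.smul_apply, smul_eq_mul, Int.gcd_eq_natAbs_gcd_natAbs, Int.natAbs_mul,
    Int.natAbs_natCast, Nat.gcd_mul_left]

/-- A nonzero integer vector is a nonzero multiple of a primitive one. -/
lemma exists_eq_smul_primitive {v : Fin 3 → ℤ} (hv : v ≠ 0) :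
    ∃ (k : ℤ) (n w : Fin 3 → ℤ), k ≠ 0 ∧ v = k • n ∧ n ⬝ᵥ w = 1 := by
  choose n hn using gcd3_dvd v
  have hvn : v = (gcd3 v : ℤ) • n := funext hn
  have hk : (gcd3 v : ℤ) ≠ 0 := fun h => hv (by rw [hvn, h, zero_smul])
  obtain ⟨w, hw⟩ := exists_dotProduct_eq_gcd3 v
  refine ⟨gcd3 v, n, w, hk, hvn, mul_left_cancel₀ hk ?_⟩
  rw [mul_one, ← smul_eq_mul, ← smul_dotProduct, ← hvn, hw]

/-- The additive map `x ↦ n ⬝ᵥ x` on `ℤ³`. -/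
def dotHom (n : Fin 3 → ℤ) : (Fin 3 → ℤ) →+ ℤ where
  toFun x := n ⬝ᵥ x
  map_zero' := dotProduct_zero n
  map_add' := dotProduct_add n

@[simp]
lemma dotHom_apply (n x : Fin 3 → ℤ) : dotHom n x = n ⬝ᵥ x := rfl

lemma dotHom_surjective {n w : Fin 3 → ℤ} (h : n ⬝ᵥ w = 1) : Function.Surjective (dotHom n) :=
  fun k => ⟨k • w, by rw [dotHom_apply, dotProduct_smul, h, smul_eq_mul, mul_one]⟩

lemma map_dotHom_ker_dotHom (m : Fin 3 → ℤ) {n w : Fin 3 → ℤ} (h : n ⬝ᵥ w = 1) :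
    (dotHom n).ker.map (dotHom m) = AddSubgroup.zmultiples (gcd3 (m ⨯₃ n) : ℤ) := by
  have triple (y : Fin 3 → ℤ) : m ⬝ᵥ (n ⨯₃ y) = (m ⨯₃ n) ⬝ᵥ y := by
    simp [cross_apply, dotProduct, Fin.sum_univ_three]; ring
  ext t
  simp only [AddSubgroup.mem_map, AddMonoidHom.mem_ker, dotHom_apply, Int.mem_zmultiples_iff]
  constructor
  · rintro ⟨x, hx, rfl⟩
    have : x = n ⨯₃ (x ⨯₃ w) := by
      simp [cross_cross_eq_smul_sub_smul', h, dotProduct_comm x n, hx]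
    rw [this, triple]
    exact Finset.dvd_sum fun i _ => (gcd3_dvd _ i).mul_right _
  · rintro ⟨k, rfl⟩
    obtain ⟨y, hy⟩ := exists_dotProduct_eq_gcd3 (m ⨯₃ n)
    refine ⟨n ⨯₃ (k • y), dot_self_cross _ _, ?_⟩
    rw [triple, dotProduct_smul, hy, smul_eq_mul, mul_comm]

lemma index_ker_dotHom_sup_ker_dotHom {m n u w : Fin 3 → ℤ} (hm : m ⬝ᵥ u = 1)
    (hn : n ⬝ᵥ w = 1) :
    ((dotHom m).ker ⊔ (dotHom n).ker).index = gcd3 (m ⨯₃ n) := by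
  rw [sup_comm, ← AddSubgroup.comap_map_eq,
    AddSubgroup.index_comap_of_surjective _ (dotHom_surjective hm),
    map_dotHom_ker_dotHom m hn, Int.index_zmultiples, Int.natAbs_natCast]

lemma index_closure_dotProduct_eq {n w : Fin 3 → ℤ} (h : n ⬝ᵥ w = 1) (p : Fin 3 → ℤ) :
    (AddSubgroup.closure {x | n ⬝ᵥ x = n ⬝ᵥ p}).index = (n ⬝ᵥ p).natAbs := by
  have : AddSubgroup.closure {x | n ⬝ᵥ x = n ⬝ᵥ p} =
      (AddSubgroup.zmultiples (n ⬝ᵥ p)).comap (dotHom n) := by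
    apply le_antisymm
    · rw [AddSubgroup.closure_le]
      intro x hx
      simp only [Set.mem_ofPred_eq] at hx
      simp [hx]
    · intro x hx
      simp only [AddSubgroup.mem_comap, dotHom_apply, Int.mem_zmultiples_iff] at hx
      obtain ⟨k, hk⟩ := hx
      rw [← sub_add_cancel x ((k - 1) • p)]
      refine add_mem (AddSubgroup.subset_closure ?_)
        (zsmul_mem (AddSubgroup.subset_closure (by simp)) _)
      simp only [Set.mem_ofPred_eq, dotProduct_sub, dotProduct_smul, hk, smul_eq_mul]
      ring
  rw [this, AddSubgroup.index_comap_of_surjective _ (dotHom_surjective h),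
    Int.index_zmultiples]

lemma det3Z_eq (a b c : Fin 3 → ℤ) : det3Z a b c =
    a 0 * (b 1 * c 2 - b 2 * c 1) - a 1 * (b 0 * c 2 - b 2 * c 0)
      + a 2 * (b 0 * c 1 - b 1 * c 0) := by
  simp [det3Z, det_fin_three]; ring

lemma det3Z_eq_cross_dotProduct (a b c : Fin 3 → ℤ) :
    det3Z a b c = ((b - a) ⨯₃ (c - a)) ⬝ᵥ a := by
  simp [det3Z_eq, cross_apply, dotProduct, Fin.sum_univ_three]; ring

lemma castR3_mem_affineSpan_iff {a b c : Fin 3 → ℤ} (h : det3Z a b c ≠ 0) (x : Fin 3 → ℤ) :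
    castR3 x ∈ affineSpan ℝ ({castR3 a, castR3 b, castR3 c} : Set (Fin 3 → ℝ)) ↔
      ((b - a) ⨯₃ (c - a)) ⬝ᵥ x = ((b - a) ⨯₃ (c - a)) ⬝ᵥ a := by
  constructor
  · intro hx
    let N : Fin 3 → ℝ := castR3 ((b - a) ⨯₃ (c - a))
    have key (y z : Fin 3 → ℤ) : N ⬝ᵥ castR3 y = N ⬝ᵥ castR3 z ↔
        ((b - a) ⨯₃ (c - a)) ⬝ᵥ y = ((b - a) ⨯₃ (c - a)) ⬝ᵥ z := by
      simp only [N, castR3, dotProduct, AddMonoidHom.coe_mk, ZeroHom.coe_mk]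
      exact_mod_cast Iff.rfl
    rw [← key]
    refine affineSpan_induction (p := fun y => N ⬝ᵥ y = N ⬝ᵥ castR3 a) hx ?_ ?_
    · rintro y (rfl | rfl | rfl)
      · rfl
      all_goals
        rw [key]
        simp [cross_apply, dotProduct, Fin.sum_univ_three]
        ring
    · intro r u v z hu hv hz
      simp [dotProduct_add, dotProduct_smul, dotProduct_sub, hu, hv, hz]
  · intro hx
    let S := affineSpan ℝ ({castR3 a, castR3 b, castR3 c} : Set (Fin 3 → ℝ))
    have ha : castR3 a ∈ S := subset_affineSpan ℝ _ (by simp)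
    have hb : castR3 b ∈ S := subset_affineSpan ℝ _ (by simp)
    have hc : castR3 c ∈ S := subset_affineSpan ℝ _ (by simp)
    have hD : (det3Z a b c : ℝ) ≠ 0 := by exact_mod_cast h
    have hmem := S.smul_vsub_vadd_mem (det3Z a b x / det3Z a b c : ℝ) hc ha
      (S.smul_vsub_vadd_mem (det3Z a x c / det3Z a b c : ℝ) hb ha ha)
    have coords (i : Fin 3) : det3Z a b c * x i = det3Z a b x * (c i - a i)
        + det3Z a x c * (b i - a i) + det3Z a b c * a i := by
      simp only [cross_apply, dotProduct, Fin.sum_univ_three, Pi.sub_apply, cons_val] at hx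
      simp only [det3Z_eq]
      fin_cases i
      · simp only [Fin.zero_eta]
        linear_combination a 0 * hx
      · simp only [Fin.mk_one]
        linear_combination a 1 * hx
      · simp only [Fin.reduceFinMk]
        linear_combination a 2 * hx
    convert hmem using 1
    ext i
    have hi : (det3Z a b c * x i : ℝ) = det3Z a b x * (c i - a i)
        + det3Z a x c * (b i - a i) + det3Z a b c * a i := by exact_mod_cast coords i
    simp only [castR3, AddMonoidHom.coe_mk, ZeroHom.coe_mk, vsub_eq_sub, vadd_eq_add,
      Pi.add_apply, Pi.smul_apply, Pi.sub_apply, smul_eq_mul]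
    field_simp
    linear_combination hi

/-- A plane through three integer points and not through the origin has a primitive normal. -/
lemma exists_primitive_normal {a b c : Fin 3 → ℤ} (h : det3Z a b c ≠ 0) :
    ∃ (k : ℤ) (n w : Fin 3 → ℤ), (b - a) ⨯₃ (c - a) = k • n ∧ n ⬝ᵥ w = 1 ∧
      ∀ x, castR3 x ∈ affineSpan ℝ ({castR3 a, castR3 b, castR3 c} : Set (Fin 3 → ℝ)) ↔
        n ⬝ᵥ x = n ⬝ᵥ a := by
  have hv : (b - a) ⨯₃ (c - a) ≠ 0 := fun hv => h (by
    rw [det3Z_eq_cross_dotProduct, hv, zero_dotProduct])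
  obtain ⟨k, n, w, hk, hkn, hw⟩ := exists_eq_smul_primitive hv
  refine ⟨k, n, w, hkn, hw, fun x => ?_⟩
  rw [castR3_mem_affineSpan_iff h, hkn, smul_dotProduct, smul_dotProduct, smul_right_inj hk]

lemma planeDiffs_eq_ker {a b c n : Fin 3 → ℤ}
    (hn : ∀ x, castR3 x ∈ affineSpan ℝ ({castR3 a, castR3 b, castR3 c} : Set (Fin 3 → ℝ)) ↔
      n ⬝ᵥ x = n ⬝ᵥ a) :
    planeDiffs a b c = (dotHom n).ker := by
  ext d
  simp only [planeDiffs, hn, Set.mem_ofPred_eq, SetLike.mem_coe, AddMonoidHom.mem_ker,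
    dotHom_apply]
  constructor
  · rintro ⟨q, hq, q', hq', rfl⟩
    rw [dotProduct_sub, hq, hq', sub_self]
  · intro hd
    exact ⟨d + a, by rw [dotProduct_add, hd, zero_add], a, rfl, (add_sub_cancel_right d a).symm⟩

lemma cross_cross_cross_eq_det3Z_smul (a b c : Fin 3 → ℤ) :
    (a ⨯₃ b) ⨯₃ (a ⨯₃ c) = det3Z a b c • a := by
  ext i
  fin_cases i <;> simp [cross_apply, det3Z_eq] <;> ring

/-- The projective lifting coefficient of the edge `p₁p₂` of an integer
surface in terms of integer invariants:
`|ω(p₁,p₂;p₃,p₄)| = Isin(π₁,π₂)/(Iℓ(p₁,p₂)·Id(O,π₁)·Id(O,π₂))`, stated in the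
equivalent product form
`|det(p₂−p₁,p₃−p₁,p₄−p₁)|·Iℓ(p₁,p₂)·Id(O,π₁)·Id(O,π₂)
  = Isin(π₁,π₂)·|det(p₁,p₂,p₃)|·|det(p₁,p₂,p₄)|`. -/
theorem lifting_coef_integer_invariants (p₁ p₂ p₃ p₄ : Fin 3 → ℤ)
    (h₃ : det3Z p₁ p₂ p₃ ≠ 0) (h₄ : det3Z p₁ p₂ p₄ ≠ 0)
    (hV : det3Z (p₂ - p₁) (p₃ - p₁) (p₄ - p₁) ≠ 0) :
    (det3Z (p₂ - p₁) (p₃ - p₁) (p₄ - p₁)).natAbs * gcd3 (p₂ - p₁)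
        * intDistOrigin p₁ p₂ p₃ * intDistOrigin p₁ p₂ p₄
      = (AddSubgroup.closure (planeDiffs p₁ p₂ p₃ ∪ planeDiffs p₁ p₂ p₄)).index
        * (det3Z p₁ p₂ p₃).natAbs * (det3Z p₁ p₂ p₄).natAbs := by
  obtain ⟨k, m, u, hkm, hu, hm⟩ := exists_primitive_normal h₃
  obtain ⟨l, n, w, hln, hw, hn⟩ := exists_primitive_normal h₄
  have hsin : (AddSubgroup.closure (planeDiffs p₁ p₂ p₃ ∪ planeDiffs p₁ p₂ p₄)).index =
      gcd3 (m ⨯₃ n) := by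
    rw [planeDiffs_eq_ker hm, planeDiffs_eq_ker hn, AddSubgroup.closure_union,
      AddSubgroup.closure_eq, AddSubgroup.closure_eq, index_ker_dotHom_sup_ker_dotHom hu hw]
  have hlen : (det3Z (p₂ - p₁) (p₃ - p₁) (p₄ - p₁)).natAbs * gcd3 (p₂ - p₁) =
      k.natAbs * (l.natAbs * gcd3 (m ⨯₃ n)) := by
    rw [← gcd3_smul, ← cross_cross_cross_eq_det3Z_smul, hkm, hln, map_smul, map_smul,
      LinearMap.smul_apply, smul_comm, gcd3_smul, gcd3_smul]
  simp only [intDistOrigin, hm, hn]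
  rw [hsin, hlen, index_closure_dotProduct_eq hu, index_closure_dotProduct_eq hw,
    det3Z_eq_cross_dotProduct p₁ p₂ p₃, det3Z_eq_cross_dotProduct p₁ p₂ p₄, hkm, hln,
    smul_dotProduct, smul_dotProduct, smul_eq_mul, smul_eq_mul, Int.natAbs_mul, Int.natAbs_mul]
  ring
end

section
/- Let p₀, p₁, p₂ ∈ ℝ³ with det(p₀,p₁,p₂) ≠ 0, let β₀, β₂ be nonzero reals and set p̄₀ = p₀/β₀, p̄₂ = p₂/β₂, let p̄₃ ∈ ℝ³ satisfy det(p₀,p₂,p̄₃) ≠ 0, and let ω̄₀₂ ∈ ℝ. If a nonzero real β₃ satisfies ω̄₀₂ = β₀β₂ · det(p₁−p₀, p₂−p₀, β₃p̄₃−p₀) / (det(p₀,p₁,p₂)·det(p₀,p₂,β₃p̄₃)), then necessarily β₃ = det(p₀,p₁,p₂) / (det(p₁−p₀, p₂−p₀, p̄₃) − ω̄₀₂·det(p₀,p₁,p₂)·det(p̄₀,p̄₂,p̄₃)); in particular β₃, and hence the lifted point p₃ = β₃p̄₃, is uniquely determined by the given face p₀p₁p₂ and the projection-stress coefficient ω̄₀₂.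 (This is the reconstruction step in the theorem that a self-stressed projection-framework of a polyhedral surface has, up to the choice of one face, a unique projective lifting.) -/
theorem det3_smul_right (a b c : Fin 3 → ℝ) (t : ℝ) :
    det3 a b (t • c) = t * det3 a b c := by
  simp [det3, Matrix.det_fin_three]
  ring

theorem det3_smul_smul_left (a b c : Fin 3 → ℝ) (s t : ℝ) :
    det3 (s • a) (t • b) c = s * t * det3 a b c := by
  simp [det3, Matrix.det_fin_three]
  ring

theorem det3_sub_base (a b c d : Fin 3 → ℝ) :
    det3 (b - a) (c - a) (d - a) = det3 (b - a) (c - a) d - det3 a b c := by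
  simp [det3, Matrix.det_fin_three]
  ring

/-- The reconstruction step of the projective lifting: the lifting
coefficient `β₃` (and hence the lifted point `p₃ = β₃pbar₃`) is uniquely
determined by the given face `p₀p₁p₂` and the projection-stress coefficient
`wbar₀₂`. -/
theorem lifting_reconstruction_unique (p₀ p₁ p₂ pbar₃ : Fin 3 → ℝ)
    (β₀ β₂ β₃ : ℝ) (wbar₀₂ : ℝ)
    (hdet : det3 p₀ p₁ p₂ ≠ 0)
    (hβ₀ : β₀ ≠ 0) (hβ₂ : β₂ ≠ 0) (hβ₃ : β₃ ≠ 0)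
    (hdet₃ : det3 p₀ p₂ pbar₃ ≠ 0)
    (heq : wbar₀₂ = β₀ * β₂ *
      (det3 (p₁ - p₀) (p₂ - p₀) (β₃ • pbar₃ - p₀) /
        (det3 p₀ p₁ p₂ * det3 p₀ p₂ (β₃ • pbar₃)))) :
    β₃ = det3 p₀ p₁ p₂ /
      (det3 (p₁ - p₀) (p₂ - p₀) pbar₃ -
        wbar₀₂ * det3 p₀ p₁ p₂ * det3 (β₀⁻¹ • p₀) (β₂⁻¹ • p₂) pbar₃) := by
  rw [det3_sub_base, det3_smul_right, det3_smul_right] at heq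
  rw [det3_smul_smul_left]
  have hden : det3 (p₁ - p₀) (p₂ - p₀) pbar₃ -
      wbar₀₂ * det3 p₀ p₁ p₂ * (β₀⁻¹ * β₂⁻¹ * det3 p₀ p₂ pbar₃) =
        det3 p₀ p₁ p₂ / β₃ := by
    rw [heq]
    field_simp
    ring
  rw [hden, div_div_cancel₀ hdet]
end
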